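/- Let P(a,b,c,z) = z⁴ − 6z² + (−2cos a − 2cos b − 2cos c − 2cos(a+b+c))·z + (3 − 2cos(a+b) − 2cos(b+c) − 2cos(a+c)). At the two points (a,b,c,z) = (0,0,0,−1) and (a,b,c,z) = (π,π,π,1), the full 4×4 Hessian matrix of P (in the variables a,b,c,z) is the zero matrix. -/

import Mathlib

open Real Matrix

/-- The characteristic polynomial of the Gyroid Harper Hamiltonian, as a
smooth real function of `(a, b, c, z)`. -/
noncomputable def P (a b c z : ℝ) : ℝ :=
  z ^ 4 - 6 * z ^ 2
    + (-2 * Real.cos a - 2 * Real.cos b - 2 * Real.cos c - 2 * Real.cos (a + b + c)) * z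
    + (3 - 2 * Real.cos (a + b) - 2 * Real.cos (b + c) - 2 * Real.cos (a + c))

/-- Partial derivative in the first variable. -/
noncomputable def pda (f : ℝ → ℝ → ℝ → ℝ → ℝ) (a b c z : ℝ) : ℝ :=
  deriv (fun t => f t b c z) a

/-- Partial derivative in the second variable. -/
noncomputable def pdb (f : ℝ → ℝ → ℝ → ℝ → ℝ) (a b c z : ℝ) : ℝ :=
  deriv (fun t => f a t c z) b

/-- Partial derivative in the third variable. -/
noncomputable def pdc (f : ℝ → ℝ → ℝ → ℝ → ℝ) (a b c z : ℝ) : ℝ :=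
  deriv (fun t => f a b t z) c

/-- Partial derivative in the fourth variable. -/
noncomputable def pdz (f : ℝ → ℝ → ℝ → ℝ → ℝ) (a b c z : ℝ) : ℝ :=
  deriv (fun t => f a b c t) z

/-- The Hessian matrix of `P` in the variables `(a, b, c, z)`, in this order. -/
noncomputable def hessP (a b c z : ℝ) : Matrix (Fin 4) (Fin 4) ℝ :=
  !![pda (pda P) a b c z, pdb (pda P) a b c z, pdc (pda P) a b c z, pdz (pda P) a b c z;
     pda (pdb P) a b c z, pdb (pdb P) a b c z, pdc (pdb P) a b c z, pdz (pdb P) a b c z;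
     pda (pdc P) a b c z, pdb (pdc P) a b c z, pdc (pdc P) a b c z, pdz (pdc P) a b c z;
     pda (pdz P) a b c z, pdb (pdz P) a b c z, pdc (pdz P) a b c z, pdz (pdz P) a b c z]

theorem hasDerivAt_cos_add_const (k x : ℝ) :
    HasDerivAt (fun t => Real.cos (t + k)) (-Real.sin (x + k)) x := by
  simpa using ((hasDerivAt_id x).add_const k).cos

theorem hasDerivAt_sin_add_const (k x : ℝ) :
    HasDerivAt (fun t => Real.sin (t + k)) (Real.cos (x + k)) x := by
  simpa using ((hasDerivAt_id x).add_const k).sin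

theorem hasDerivAt_P_fst (a b c z : ℝ) :
    HasDerivAt (fun t => P t b c z)
      (2 * z * (Real.sin a + Real.sin (a + b + c))
        + 2 * (Real.sin (a + b) + Real.sin (a + c))) a := by
  have h := ((((Real.hasDerivAt_cos a).add (hasDerivAt_cos_add_const (b + c) a)).const_mul
    (-2 * z)).add (((hasDerivAt_cos_add_const b a).add
    (hasDerivAt_cos_add_const c a)).const_mul (-2))).add_const
    (z ^ 4 - 6 * z ^ 2 + (-2 * Real.cos b - 2 * Real.cos c) * z + 3 - 2 * Real.cos (b + c))
  rw [← add_assoc] at h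
  refine (h.congr_of_eventuallyEq (.of_forall fun t => ?_)).congr_deriv (by ring)
  simp only [P, Pi.add_apply, ← add_assoc]
  ring

theorem P_swap_fst_snd (a b c z : ℝ) : P a b c z = P b a c z := by
  simp only [P, add_comm a b]
  ring

theorem P_swap_fst_trd (a b c z : ℝ) : P a b c z = P c b a z := by
  simp only [P, add_comm a b, add_comm b c, add_comm a c,
    show b + a + c = c + b + a by ring]
  ring

theorem pda_P (a b c z : ℝ) :
    pda P a b c z = 2 * z * (Real.sin a + Real.sin (a + b + c))
      + 2 * (Real.sin (a + b) + Real.sin (a + c)) :=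
  (hasDerivAt_P_fst a b c z).deriv

theorem pdb_P (a b c z : ℝ) : pdb P a b c z = pda P b a c z := by
  simp only [pda, pdb, P_swap_fst_snd a]

theorem pdc_P (a b c z : ℝ) : pdc P a b c z = pda P c b a z := by
  simp only [pda, pdc, P_swap_fst_trd a]

theorem pdz_P (a b c z : ℝ) :
    pdz P a b c z = 4 * z ^ 3 - 12 * z
      - 2 * (Real.cos a + Real.cos b + Real.cos c + Real.cos (a + b + c)) := by
  have h := (((hasDerivAt_pow 4 z).sub ((hasDerivAt_pow 2 z).const_mul 6)).add
    ((hasDerivAt_id z).const_mul (-2 * Real.cos a - 2 * Real.cos b - 2 * Real.cos c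
      - 2 * Real.cos (a + b + c)))).add_const
    (3 - 2 * Real.cos (a + b) - 2 * Real.cos (b + c) - 2 * Real.cos (a + c))
  refine Eq.trans (HasDerivAt.deriv h) ?_
  norm_num
  ring

theorem pda_pda_P (a b c z : ℝ) :
    pda (pda P) a b c z = 2 * z * (Real.cos a + Real.cos (a + b + c))
      + 2 * (Real.cos (a + b) + Real.cos (a + c)) := by
  have h := (((Real.hasDerivAt_sin a).add (hasDerivAt_sin_add_const (b + c) a)).const_mul
    (2 * z)).add (((hasDerivAt_sin_add_const b a).add
    (hasDerivAt_sin_add_const c a)).const_mul 2)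
  rw [← add_assoc] at h
  refine Eq.trans (congrArg (fun f => deriv f a) ?_) h.deriv
  funext t
  simp only [pda_P, Pi.add_apply, ← add_assoc]

theorem pdb_pda_P (a b c z : ℝ) :
    pdb (pda P) a b c z = 2 * z * Real.cos (a + b + c) + 2 * Real.cos (a + b) := by
  have h := (((hasDerivAt_sin_add_const (a + c) b).const_mul (2 * z)).add
    ((hasDerivAt_sin_add_const a b).const_mul 2)).add_const
    (2 * z * Real.sin a + 2 * Real.sin (a + c))
  rw [show b + (a + c) = a + b + c by ring, add_comm b a] at h
  refine Eq.trans (congrArg (fun f => deriv f b) ?_) h.deriv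
  funext t
  simp only [pda_P, Pi.add_apply, add_comm t a, show t + (a + c) = a + t + c by ring]
  ring

theorem pda_P_swap (a b c z : ℝ) : pda P a b c z = pda P a c b z := by
  simp only [pda_P, show a + c + b = a + b + c by ring]
  ring

theorem pdz_pda_P (a b c z : ℝ) :
    pdz (pda P) a b c z = 2 * (Real.sin a + Real.sin (a + b + c)) := by
  have h := ((hasDerivAt_id z).const_mul (2 * (Real.sin a + Real.sin (a + b + c)))).add_const
    (2 * (Real.sin (a + b) + Real.sin (a + c)))
  rw [mul_one] at h
  refine Eq.trans (congrArg (fun f => deriv f z) ?_) h.deriv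
  funext t
  simp only [pda_P, id]
  ring

theorem pda_pdz_P (a b c z : ℝ) :
    pda (pdz P) a b c z = 2 * (Real.sin a + Real.sin (a + b + c)) := by
  have h := (((Real.hasDerivAt_cos a).add (hasDerivAt_cos_add_const (b + c) a)).const_mul
    (-2)).add_const (4 * z ^ 3 - 12 * z - 2 * (Real.cos b + Real.cos c))
  rw [← add_assoc] at h
  refine Eq.trans (congrArg (fun f => deriv f a) ?_) (h.deriv.trans (by ring))
  funext t
  simp only [pdz_P, Pi.add_apply, ← add_assoc]
  ring

theorem pdz_pdz_P (a b c z : ℝ) : pdz (pdz P) a b c z = 12 * z ^ 2 - 12 := by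
  have h := (((hasDerivAt_pow 3 z).const_mul 4).sub ((hasDerivAt_id z).const_mul 12)).sub_const
    (2 * (Real.cos a + Real.cos b + Real.cos c + Real.cos (a + b + c)))
  refine Eq.trans (congrArg (fun f => deriv f z) ?_) (h.deriv.trans (by norm_num; ring))
  funext t
  simp only [pdz_P, Pi.sub_apply, id]

theorem pdz_P_swap_fst_snd (a b c z : ℝ) : pdz P a b c z = pdz P b a c z := by
  simp only [pdz, P_swap_fst_snd a]

theorem pdz_P_swap_fst_trd (a b c z : ℝ) : pdz P a b c z = pdz P c b a z := by
  simp only [pdz, P_swap_fst_trd a]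

theorem pdc_pda_P (a b c z : ℝ) : pdc (pda P) a b c z = pdb (pda P) a c b z := by
  simp only [pdc, pdb, pda_P_swap a b]

theorem hessP_diagonal (x z : ℝ) :
    hessP x x x z =
      let d := 2 * z * (Real.cos x + Real.cos (3 * x)) + 4 * Real.cos (2 * x)
      let m := 2 * z * Real.cos (3 * x) + 2 * Real.cos (2 * x)
      let s := 2 * (Real.sin x + Real.sin (3 * x))
      !![d, m, m, s; m, d, m, s; m, m, d, s; s, s, s, 12 * z ^ 2 - 12] := by
  have h2 : x + x = 2 * x := by ring
  have h3 : 2 * x + x = 3 * x := by ring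
  have hd : pda (pda P) x x x z
      = 2 * z * (Real.cos x + Real.cos (3 * x)) + 4 * Real.cos (2 * x) := by
    rw [pda_pda_P, h2, h3]; ring
  have hm : pdb (pda P) x x x z = 2 * z * Real.cos (3 * x) + 2 * Real.cos (2 * x) := by
    rw [pdb_pda_P, h2, h3]
  have hs : pdz (pda P) x x x z = 2 * (Real.sin x + Real.sin (3 * x)) := by
    rw [pdz_pda_P, h2, h3]
  have hs' : pda (pdz P) x x x z = 2 * (Real.sin x + Real.sin (3 * x)) := by
    rw [pda_pdz_P, h2, h3]
  have hm' : pdc (pda P) x x x z = pdb (pda P) x x x z := pdc_pda_P x x x z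
  have hba : pda (pdb P) x x x z = pdb (pda P) x x x z :=
    congrArg (fun f => deriv f x) (funext fun t => pdb_P t x x z)
  have hbb : pdb (pdb P) x x x z = pda (pda P) x x x z :=
    congrArg (fun f => deriv f x) (funext fun t => pdb_P x t x z)
  have hbc : pdc (pdb P) x x x z = pdc (pda P) x x x z :=
    congrArg (fun f => deriv f x) (funext fun t => pdb_P x x t z)
  have hbz : pdz (pdb P) x x x z = pdz (pda P) x x x z :=
    congrArg (fun f => deriv f z) (funext fun t => pdb_P x x x t)
  have hca : pda (pdc P) x x x z = pdc (pda P) x x x z :=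
    congrArg (fun f => deriv f x) (funext fun t => pdc_P t x x z)
  have hcb : pdb (pdc P) x x x z = pdb (pda P) x x x z :=
    congrArg (fun f => deriv f x) (funext fun t => pdc_P x t x z)
  have hcc : pdc (pdc P) x x x z = pda (pda P) x x x z :=
    congrArg (fun f => deriv f x) (funext fun t => pdc_P x x t z)
  have hcz : pdz (pdc P) x x x z = pdz (pda P) x x x z :=
    congrArg (fun f => deriv f z) (funext fun t => pdc_P x x x t)
  have hzb : pdb (pdz P) x x x z = pda (pdz P) x x x z :=
    congrArg (fun f => deriv f x) (funext fun t => pdz_P_swap_fst_snd x t x z)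
  have hzc : pdc (pdz P) x x x z = pda (pdz P) x x x z :=
    congrArg (fun f => deriv f x) (funext fun t => pdz_P_swap_fst_trd x x t z)
  simp only [hessP, hba, hbb, hbc, hbz, hca, hcb, hcc, hcz, hzb, hzc, hm', hd, hm, hs, hs',
    pdz_pdz_P]

theorem gyroid_triple_points_hessian_vanishes :
    hessP 0 0 0 (-1) = 0 ∧ hessP π π π 1 = 0 := by
  have hc3 : Real.cos (3 * π) = -1 := by
    rw [Real.cos_three_mul, Real.cos_pi]; norm_num
  have hs3 : Real.sin (3 * π) = 0 := by
    rw [Real.sin_three_mul, Real.sin_pi]; norm_num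
  constructor
  · rw [hessP_diagonal]
    ext i j
    fin_cases i <;> fin_cases j <;> norm_num
  · rw [hessP_diagonal]
    ext i j
    fin_cases i <;> fin_cases j <;> norm_num [hc3, hs3]
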